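/- For every λ > 0, the 2-quasiconvexification of F_λ is given explicitly by Q₂F_λ(ξ) = 2√λ·ρ⁰(ξ) − 2|det ξ| if ρ⁰(ξ) ≤ √λ, and Q₂F_λ(ξ) = |ξ|² + λ if ρ⁰(ξ) > √λ, for every real symmetric 2×2 matrix ξ. -/

import Mathlib

open Matrix Set Real MeasureTheory

/-- First eigenvalue of a (symmetric) 2×2 real matrix. -/
noncomputable def eig1 (ξ : Matrix (Fin 2) (Fin 2) ℝ) : ℝ :=
  (ξ.trace + Real.sqrt (ξ.trace ^ 2 - 4 * ξ.det)) / 2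

/-- Second eigenvalue of a (symmetric) 2×2 real matrix. -/
noncomputable def eig2 (ξ : Matrix (Fin 2) (Fin 2) ℝ) : ℝ :=
  (ξ.trace - Real.sqrt (ξ.trace ^ 2 - 4 * ξ.det)) / 2

/-- ρ⁰(ξ) = |λ₁(ξ)| + |λ₂(ξ)|. -/
noncomputable def rho0 (ξ : Matrix (Fin 2) (Fin 2) ℝ) : ℝ :=
  |eig1 ξ| + |eig2 ξ|

/-- F_λ(0) = 0 and F_λ(ξ) = λ + |ξ|² for ξ ≠ 0, with |ξ| the Frobenius norm. -/
noncomputable def Flam (lam : ℝ) (ξ : Matrix (Fin 2) (Fin 2) ℝ) : ℝ :=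
  if ξ = 0 then 0 else lam + ∑ i, ∑ j, (ξ i j) ^ 2

/-- The square [−1/2,1/2]². -/
def symSquare : Set (Fin 2 → ℝ) :=
  Set.pi Set.univ fun _ => Set.Icc (-(1 / 2) : ℝ) (1 / 2)

/-- Membership in `W^{2,∞}₀` of the square [−1/2,1/2]²: C¹ with Lipschitz gradient,
vanishing together with its gradient on the boundary of the square. -/
def MemW2inf0 (φ : (Fin 2 → ℝ) → ℝ) : Prop :=
  ContDiff ℝ 1 φ ∧ (∃ K : NNReal, LipschitzWith K fun x => fderiv ℝ φ x) ∧
    ∀ x ∈ frontier symSquare, φ x = 0 ∧ fderiv ℝ φ x = 0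

/-- The (a.e. defined, by Rademacher's theorem) Hessian of φ. -/
noncomputable def hess (φ : (Fin 2 → ℝ) → ℝ) (x : Fin 2 → ℝ) :
    Matrix (Fin 2) (Fin 2) ℝ :=
  Matrix.of fun i j =>
    fderiv ℝ (fun y => fderiv ℝ φ y (Pi.single j 1)) x (Pi.single i 1)

/-- The 2-quasiconvexification of f. -/
noncomputable def Q2 (f : Matrix (Fin 2) (Fin 2) ℝ → ℝ)
    (ξ : Matrix (Fin 2) (Fin 2) ℝ) : ℝ :=
  sInf { v : ℝ | ∃ φ : (Fin 2 → ℝ) → ℝ, MemW2inf0 φ ∧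
    v = ∫ x in symSquare, f (ξ + hess φ x) }

/-- Ḡ_λ(ξ) = 2√λ ρ⁰(ξ) − 2|det ξ| if ρ⁰(ξ) ≤ √λ, and |ξ|² + λ otherwise. -/
noncomputable def Gbar (lam : ℝ) (ξ : Matrix (Fin 2) (Fin 2) ℝ) : ℝ :=
  if rho0 ξ ≤ Real.sqrt lam then 2 * Real.sqrt lam * rho0 ξ - 2 * |ξ.det|
  else (∑ i, ∑ j, (ξ i j) ^ 2) + lam

open Filter Topology

theorem hasCompactSupport_sub_translate {E : Type*} [NormedAddCommGroup E]
    {f : E → ℝ} (hcf : HasCompactSupport f) (w : E) (t : ℝ) :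
    HasCompactSupport (fun x => t * (f (x + w) - f x)) := by
  have h1 : HasCompactSupport (fun x => f (x + w)) :=
    hcf.comp_homeomorph (Homeomorph.addRight w)
  exact (h1.sub hcf).mul_left (f := fun _ => t)

section NullLagrangian

variable {E : Type*} [NormedAddCommGroup E] [NormedSpace ℝ E] [FiniteDimensional ℝ E]
  [MeasurableSpace E] [BorelSpace E] {μ : Measure E} [μ.IsAddHaarMeasure]

/-- Line derivatives of a compactly supported Lipschitz function have zero mean. -/
theorem integral_lineDeriv_eq_zero {C : NNReal} {f : E → ℝ} (hf : LipschitzWith C f)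
    (hcf : HasCompactSupport f) (v : E) : ∫ x, lineDeriv ℝ f x v ∂μ = 0 := by
  have h := LipschitzWith.integral_lineDeriv_mul_eq (μ := μ) (LipschitzWith.const (1 : ℝ))
    hf hcf (-v)
  have h0 : ∀ x : E, lineDeriv ℝ (fun _ : E => (1 : ℝ)) x (-v) = 0 := by
    intro x; simp [lineDeriv]
  simpa [h0] using h.symm

/-- The line derivative of a Lipschitz function with compact support is integrable. -/
theorem integrable_lineDeriv_of_hasCompactSupport {C : NNReal} {f : E → ℝ} (hf : LipschitzWith C f)
    (hcf : HasCompactSupport f) (v : E) : Integrable (fun x => lineDeriv ℝ f x v) μ := by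
  refine (integrableOn_iff_integrable_of_support_subset (s := tsupport f) ?_).1 ?_
  · intro x hx
    by_contra hxn
    apply hx
    have h0 : f =ᶠ[𝓝 x] fun _ => 0 := by
      have := (isClosed_tsupport f).isOpen_compl.mem_nhds hxn
      filter_upwards [this] with y hy
      exact image_eq_zero_of_notMem_tsupport hy
    change lineDeriv ℝ f x v = 0
    rw [h0.lineDeriv_eq]
    simp [lineDeriv]
  · exact (hf.locallyIntegrable_lineDeriv v).integrableOn_isCompact hcf

/-- The Jacobian minor of two Lipschitz functions, one of them compactly supported,
is a null Lagrangian. -/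
theorem integral_lineDeriv_mul_lineDeriv_comm {C D : NNReal} {f g : E → ℝ}
    (hf : LipschitzWith C f) (hcf : HasCompactSupport f)
    (hg : LipschitzWith D g) (hcg : HasCompactSupport g) (v w : E) :
    ∫ x, lineDeriv ℝ f x v * lineDeriv ℝ g x w ∂μ =
      ∫ x, lineDeriv ℝ f x w * lineDeriv ℝ g x v ∂μ := by
  have hA := LipschitzWith.integral_inv_smul_sub_mul_tendsto_integral_lineDeriv_mul (μ := μ) hf
    (integrable_lineDeriv_of_hasCompactSupport (μ := μ) hg hcg w) v
  have hB := LipschitzWith.integral_inv_smul_sub_mul_tendsto_integral_lineDeriv_mul (μ := μ) hg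
    (integrable_lineDeriv_of_hasCompactSupport (μ := μ) hf hcf w) (-v)
  have key : ∀ t : ℝ, ∫ x, (t⁻¹ • (f (x + t • v) - f x)) * lineDeriv ℝ g x w ∂μ =
      -∫ x, (t⁻¹ • (g (x + t • (-v)) - g x)) * lineDeriv ℝ f x w ∂μ := by
    intro t
    have hft : LipschitzWith C (fun x => f (x + t • v)) := by
      have := hf.comp (LipschitzWith.id.add (LipschitzWith.const (α := E) (t • v)))
      simpa [Function.comp_def] using this
    have hL : ∃ K, LipschitzWith K (fun x => t⁻¹ * (f (x + t • v) - f x)) :=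
      ⟨_, (lipschitzWith_smul (t⁻¹ : ℝ)).comp (hft.sub hf)⟩
    obtain ⟨K, hK⟩ := hL
    have h1 := LipschitzWith.integral_lineDeriv_mul_eq (μ := μ) hg hK
      (hasCompactSupport_sub_translate hcf (t • v) t⁻¹) w
    have h2 : ∀ᵐ x ∂μ, lineDeriv ℝ (fun x => t⁻¹ * (f (x + t • v) - f x)) x (-w) =
        -(t⁻¹ * (lineDeriv ℝ f (x + t • v) w - lineDeriv ℝ f x w)) := by
      have ha := hf.ae_lineDifferentiableAt (μ := μ) w
      have hb : ∀ᵐ x ∂μ, LineDifferentiableAt ℝ f (x + t • v) w :=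
        (quasiMeasurePreserving_add_right μ (t • v)).ae ha
      filter_upwards [ha, hb] with x hx hx'
      rw [lineDeriv_neg]
      have e1 := hx.hasLineDerivAt
      have e2 : HasLineDerivAt ℝ (fun y => f (y + t • v)) (lineDeriv ℝ f (x + t • v) w) x w := by
        have := hx'.hasLineDerivAt
        unfold HasLineDerivAt at this ⊢
        convert this using 3
        abel
      have e3 : HasLineDerivAt ℝ (fun x => t⁻¹ * (f (x + t • v) - f x))
          (t⁻¹ * (lineDeriv ℝ f (x + t • v) w - lineDeriv ℝ f x w)) x w := by
        unfold HasLineDerivAt at e1 e2 ⊢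
        exact (e2.sub e1).const_mul _
      rw [e3.lineDeriv]
    simp only [smul_eq_mul]
    have h3 : ∫ x, t⁻¹ * (f (x + t • v) - f x) * lineDeriv ℝ g x w ∂μ =
      ∫ x, lineDeriv ℝ g x w * (t⁻¹ * (f (x + t • v) - f x)) ∂μ := by
      simp_rw [mul_comm]
    rw [h3, h1, integral_congr_ae (h2.mono fun x hx => congrArg (· * g x) hx)]
    have hfi := integrable_lineDeriv_of_hasCompactSupport (μ := μ) hf hcf w
    have i1 : Integrable (fun x => lineDeriv ℝ f x w * g x) μ :=
      hfi.mul_of_top_left (hg.continuous.memLp_top_of_hasCompactSupport hcg μ)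
    have i2 : Integrable (fun x => lineDeriv ℝ f (x + t • v) w * g x) μ :=
      (hfi.comp_add_right (t • v)).mul_of_top_left
        (hg.continuous.memLp_top_of_hasCompactSupport hcg μ)
    have i3 : Integrable (fun x => lineDeriv ℝ f x w * g (x - t • v)) μ := by
      simpa [sub_eq_add_neg, add_assoc] using i2.comp_add_right (-(t • v))
    have tr : ∫ x, lineDeriv ℝ f (x + t • v) w * g x ∂μ =
        ∫ x, lineDeriv ℝ f x w * g (x - t • v) ∂μ := by
      rw [← integral_add_right_eq_self (fun x => lineDeriv ℝ f x w * g (x - t • v)) (t • v)]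
      simp
    have e1 : ∀ x, -(t⁻¹ * (lineDeriv ℝ f (x + t • v) w - lineDeriv ℝ f x w)) * g x =
        (-t⁻¹) * (lineDeriv ℝ f (x + t • v) w * g x - lineDeriv ℝ f x w * g x) := by
      intro x; ring
    have e2 : ∀ x, t⁻¹ * (g (x + t • (-v)) - g x) * lineDeriv ℝ f x w =
        t⁻¹ * (lineDeriv ℝ f x w * g (x - t • v) - lineDeriv ℝ f x w * g x) := by
      intro x; rw [smul_neg, ← sub_eq_add_neg]; ring
    simp_rw [e1, e2]
    rw [integral_const_mul, integral_const_mul, integral_sub i2 i1, integral_sub i3 i1, tr]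
    ring
  have hC : Tendsto (fun t : ℝ => ∫ x, (t⁻¹ • (f (x + t • v) - f x)) * lineDeriv ℝ g x w ∂μ)
      (𝓝[>] 0) (𝓝 (-∫ x, lineDeriv ℝ g x (-v) * lineDeriv ℝ f x w ∂μ)) := by
    simp_rw [key]
    exact hB.neg
  rw [tendsto_nhds_unique hA hC, ← integral_neg]
  congr 1
  ext x
  rw [lineDeriv_neg]
  ring

end NullLagrangian

theorem symSquare_eq_closedBall : symSquare = Metric.closedBall (0 : Fin 2 → ℝ) (1 / 2) := by
  ext x
  rw [mem_closedBall_zero_iff, pi_norm_le_iff_of_nonneg (by norm_num)]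
  simp only [symSquare, Set.mem_univ_pi, Set.mem_Icc, Real.norm_eq_abs, abs_le]

theorem isCompact_symSquare : IsCompact symSquare := by
  rw [symSquare_eq_closedBall]; exact isCompact_closedBall _ _

theorem measurableSet_symSquare : MeasurableSet symSquare :=
  isCompact_symSquare.isClosed.measurableSet

theorem volume_symSquare : volume symSquare = 1 := by
  rw [symSquare, volume_pi_pi]
  norm_num [Real.volume_Icc]

theorem volume_frontier_symSquare : volume (frontier symSquare) = 0 := by
  rw [symSquare_eq_closedBall]
  exact (convex_closedBall _ _).addHaar_frontier _

/-- The retraction of the plane onto the square, clamping each coordinate. -/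
noncomputable def squareRetract (x : Fin 2 → ℝ) : Fin 2 → ℝ :=
  fun i => max (min (x i) (1 / 2)) (-(1 / 2))

theorem lipschitzWith_squareRetract : LipschitzWith 1 squareRetract := by
  refine LipschitzWith.of_dist_le_mul fun x y => ?_
  rw [NNReal.coe_one, one_mul, dist_pi_le_iff dist_nonneg]
  intro i
  refine le_trans ?_ (dist_le_pi_dist x y i)
  rw [Real.dist_eq, Real.dist_eq]
  refine (abs_max_sub_max_le_abs _ _ _).trans ((abs_min_sub_min_le_max _ _ _ _).trans ?_)
  simp

theorem squareRetract_of_mem {x : Fin 2 → ℝ} (hx : x ∈ symSquare) : squareRetract x = x := by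
  ext i
  have := hx i (mem_univ i)
  simp only [Set.mem_Icc] at this
  rw [squareRetract, min_eq_left this.2, max_eq_left this.1]

theorem squareRetract_mem_frontier {x : Fin 2 → ℝ} (hx : x ∉ symSquare) :
    squareRetract x ∈ frontier symSquare := by
  have hmem : squareRetract x ∈ symSquare := by
    intro i _
    simp only [squareRetract, Set.mem_Icc]
    exact ⟨le_max_right _ _, max_le (min_le_right _ _) (by norm_num)⟩
  rw [symSquare_eq_closedBall] at hmem ⊢
  rw [frontier_closedBall _ (by norm_num), mem_sphere_zero_iff_norm]
  refine le_antisymm (mem_closedBall_zero_iff.1 hmem) ?_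
  have : ∃ i, x i < -(1 / 2) ∨ 1 / 2 < x i := by
    by_contra! h
    exact hx fun i _ => ⟨(h i).1, (h i).2⟩
  obtain ⟨i, hi⟩ := this
  refine le_trans ?_ (norm_le_pi_norm (squareRetract x) i)
  rw [Real.norm_eq_abs]
  rcases hi with hi | hi
  · have : squareRetract x i = -(1 / 2) := by
      simp only [squareRetract]
      exact max_eq_right ((min_le_left _ _).trans hi.le)
    rw [this, abs_neg]; exact le_abs_self _
  · have : squareRetract x i = 1 / 2 := by
      simp only [squareRetract]
      rw [min_eq_right hi.le]; norm_num
    rw [this]; exact le_abs_self _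

/-- A Lipschitz function vanishing on the boundary of the square agrees on the square with a
compactly supported Lipschitz function; the line derivatives of the latter are, almost everywhere,
those of the former on the square and zero outside. -/
theorem exists_lipschitz_extension {K : NNReal} {u : (Fin 2 → ℝ) → ℝ} (hu : LipschitzWith K u)
    (h0 : ∀ x ∈ frontier symSquare, u x = 0) :
    ∃ w : (Fin 2 → ℝ) → ℝ, LipschitzWith K w ∧ HasCompactSupport w ∧
      ∀ᵐ x, ∀ v, lineDeriv ℝ w x v = symSquare.indicator (fun x => fderiv ℝ u x v) x := by
  have hl : LipschitzWith K (u ∘ squareRetract) := by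
    simpa using hu.comp lipschitzWith_squareRetract
  have hz : ∀ x, x ∉ symSquare → (u ∘ squareRetract) x = 0 := fun x hx =>
    h0 _ (squareRetract_mem_frontier hx)
  refine ⟨u ∘ squareRetract, hl, HasCompactSupport.intro isCompact_symSquare hz, ?_⟩
  have hf : ∀ᵐ x : Fin 2 → ℝ, x ∉ frontier symSquare :=
    measure_eq_zero_iff_ae_notMem.1 volume_frontier_symSquare
  filter_upwards [hf, hu.ae_differentiableAt] with x hx hd v
  by_cases hxs : x ∈ symSquare
  · have hxi : x ∈ interior symSquare := by
      rw [← self_sdiff_frontier]; exact ⟨hxs, hx⟩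
    have he : (u ∘ squareRetract) =ᶠ[𝓝 x] u := by
      filter_upwards [mem_interior_iff_mem_nhds.1 hxi] with y hy
      simp [squareRetract_of_mem hy]
    rw [he.lineDeriv_eq, indicator_of_mem hxs, hd.lineDeriv_eq_fderiv]
  · have he : (u ∘ squareRetract) =ᶠ[𝓝 x] fun _ => 0 := by
      filter_upwards [isCompact_symSquare.isClosed.isOpen_compl.mem_nhds hxs] with y hy
      exact hz y hy
    rw [he.lineDeriv_eq, indicator_of_notMem hxs]
    simp [lineDeriv]

theorem setIntegral_fderiv_eq_zero {K : NNReal} {u : (Fin 2 → ℝ) → ℝ} (hu : LipschitzWith K u)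
    (h0 : ∀ x ∈ frontier symSquare, u x = 0) (v : Fin 2 → ℝ) :
    ∫ x in symSquare, fderiv ℝ u x v = 0 := by
  obtain ⟨w, hw, hcw, hae⟩ := exists_lipschitz_extension hu h0
  rw [← integral_indicator measurableSet_symSquare,
    ← integral_lineDeriv_eq_zero (μ := volume) hw hcw v]
  exact integral_congr_ae (hae.mono fun x hx => (hx v).symm)

theorem setIntegral_fderiv_mul_fderiv_comm {K K' : NNReal} {u u' : (Fin 2 → ℝ) → ℝ}
    (hu : LipschitzWith K u) (h0 : ∀ x ∈ frontier symSquare, u x = 0)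
    (hu' : LipschitzWith K' u') (h0' : ∀ x ∈ frontier symSquare, u' x = 0) (v v' : Fin 2 → ℝ) :
    ∫ x in symSquare, fderiv ℝ u x v * fderiv ℝ u' x v' =
      ∫ x in symSquare, fderiv ℝ u x v' * fderiv ℝ u' x v := by
  obtain ⟨w, hw, hcw, hae⟩ := exists_lipschitz_extension hu h0
  obtain ⟨w', hw', hcw', hae'⟩ := exists_lipschitz_extension hu' h0'
  have key : ∀ v v', ∫ x in symSquare, fderiv ℝ u x v * fderiv ℝ u' x v' =
      ∫ x, lineDeriv ℝ w x v * lineDeriv ℝ w' x v' := by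
    intro v v'
    rw [← integral_indicator measurableSet_symSquare]
    refine integral_congr_ae ?_
    filter_upwards [hae, hae'] with x hx hx'
    rw [hx, hx']
    by_cases h : x ∈ symSquare <;> simp [h]
  rw [key, key, integral_lineDeriv_mul_lineDeriv_comm hw hcw hw' hcw']

namespace MemW2inf0

variable {φ : (Fin 2 → ℝ) → ℝ}

theorem lipschitz_partial (hφ : MemW2inf0 φ) (j : Fin 2) :
    (∃ K, LipschitzWith K fun y => fderiv ℝ φ y (Pi.single j 1)) ∧
      ∀ x ∈ frontier symSquare, fderiv ℝ φ x (Pi.single j 1) = 0 := by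
  obtain ⟨-, ⟨K, hK⟩, h0⟩ := hφ
  refine ⟨⟨_, (ContinuousLinearMap.apply ℝ ℝ (Pi.single j 1 : Fin 2 → ℝ)).lipschitz.comp hK⟩, ?_⟩
  intro x hx
  rw [(h0 x hx).2]; simp

theorem setIntegral_hess (hφ : MemW2inf0 φ) (i j : Fin 2) :
    ∫ x in symSquare, hess φ x i j = 0 := by
  obtain ⟨⟨K, hK⟩, h0⟩ := hφ.lipschitz_partial j
  exact setIntegral_fderiv_eq_zero hK h0 _

theorem exists_abs_hess_le (hφ : MemW2inf0 φ) :
    ∃ K : ℝ, ∀ x i j, |hess φ x i j| ≤ K := by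
  have (j : Fin 2) : ∃ K : ℝ, ∀ x i, |hess φ x i j| ≤ K := by
    obtain ⟨⟨K, hK⟩, -⟩ := hφ.lipschitz_partial j
    refine ⟨K, fun x i => ?_⟩
    have h1 := (fderiv ℝ (fun y => fderiv ℝ φ y (Pi.single j 1)) x).le_opNorm (Pi.single i 1)
    have h2 : ‖(Pi.single i 1 : Fin 2 → ℝ)‖ = 1 := by
      simp [Pi.norm_single]
    rw [h2, mul_one] at h1
    exact h1.trans (norm_fderiv_le_of_lipschitz ℝ hK)
  choose K hK using this
  refine ⟨max (K 0) (K 1), fun x i j => ?_⟩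
  fin_cases j
  · exact (hK 0 x i).trans (le_max_left _ _)
  · exact (hK 1 x i).trans (le_max_right _ _)

end MemW2inf0

theorem measurable_hess (φ : (Fin 2 → ℝ) → ℝ) (i j : Fin 2) :
    Measurable fun x => hess φ x i j :=
  measurable_fderiv_apply_const ℝ _ _

/-- A bounded measurable function is integrable on the square. -/
theorem integrableOn_symSquare_of_bounded {f : (Fin 2 → ℝ) → ℝ} (hf : Measurable f) {C : ℝ}
    (hC : ∀ x, |f x| ≤ C) : IntegrableOn f symSquare :=
  Measure.integrableOn_of_bounded (M := C) (by rw [volume_symSquare]; simp)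
    hf.aestronglyMeasurable (Eventually.of_forall hC)

theorem integral_affine_combination {α : Type*} [MeasurableSpace α] {μ : Measure α}
    [IsFiniteMeasure μ] {p q r s t : α → ℝ} (hp : Integrable p μ) (hq : Integrable q μ)
    (hr : Integrable r μ) (hs : Integrable s μ) (ht : Integrable t μ) (k a b c d e : ℝ) :
    Integrable (fun x => k + (a * p x + b * q x + c * r x + d * s x + e * t x)) μ ∧
    ∫ x, (k + (a * p x + b * q x + c * r x + d * s x + e * t x)) ∂μ =
      μ.real univ * k + (a * ∫ x, p x ∂μ) + (b * ∫ x, q x ∂μ) + (c * ∫ x, r x ∂μ)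
        + (d * ∫ x, s x ∂μ) + e * ∫ x, t x ∂μ := by
  have h1 := hp.const_mul a
  have h2 : Integrable (fun x => a * p x + b * q x) μ := h1.add (hq.const_mul b)
  have h3 : Integrable (fun x => a * p x + b * q x + c * r x) μ := h2.add (hr.const_mul c)
  have h4 : Integrable (fun x => a * p x + b * q x + c * r x + d * s x) μ :=
    h3.add (hs.const_mul d)
  have h5 : Integrable (fun x => a * p x + b * q x + c * r x + d * s x + e * t x) μ :=
    h4.add (ht.const_mul e)
  refine ⟨(integrable_const k).add h5, ?_⟩
  rw [integral_add (integrable_const k) h5, integral_add h4 (ht.const_mul e),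
    integral_add h3 (hs.const_mul d), integral_add h2 (hr.const_mul c),
    integral_add h1 (hq.const_mul b)]
  simp only [integral_const_mul, integral_const, smul_eq_mul]
  ring

instance : IsFiniteMeasure (volume.restrict symSquare) :=
  isFiniteMeasure_restrict.2 (by rw [volume_symSquare]; simp)

namespace MemW2inf0

variable {φ : (Fin 2 → ℝ) → ℝ}

theorem integrableOn_hess (hφ : MemW2inf0 φ) (i j : Fin 2) :
    IntegrableOn (fun x => hess φ x i j) symSquare := by
  obtain ⟨K, hK⟩ := hφ.exists_abs_hess_le
  exact integrableOn_symSquare_of_bounded (measurable_hess φ i j) fun x => hK x i j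

theorem integrableOn_hess_mul (hφ : MemW2inf0 φ) (i j k l : Fin 2) :
    IntegrableOn (fun x => hess φ x i j * hess φ x k l) symSquare := by
  obtain ⟨K, hK⟩ := hφ.exists_abs_hess_le
  refine integrableOn_symSquare_of_bounded (C := K * K)
    ((measurable_hess φ i j).mul (measurable_hess φ k l)) fun x => ?_
  rw [abs_mul]
  exact mul_le_mul (hK x i j) (hK x k l) (abs_nonneg _) ((abs_nonneg _).trans (hK x i j))

theorem setIntegral_hess_mul (hφ : MemW2inf0 φ) :
    ∫ x in symSquare, hess φ x 0 0 * hess φ x 1 1 =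
      ∫ x in symSquare, hess φ x 0 1 * hess φ x 1 0 := by
  obtain ⟨⟨K, hK⟩, h0⟩ := hφ.lipschitz_partial 0
  obtain ⟨⟨K', hK'⟩, h0'⟩ := hφ.lipschitz_partial 1
  have := setIntegral_fderiv_mul_fderiv_comm hK h0 hK' h0' (Pi.single 0 1) (Pi.single 1 1)
  simp_rw [mul_comm (hess φ _ 0 1)]
  exact this

/-- Affine functions plus a multiple of the determinant are null Lagrangians for Hessians. -/
theorem setIntegral_nullLagrangian (hφ : MemW2inf0 φ) (ξ : Matrix (Fin 2) (Fin 2) ℝ)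
    (k a b c d e : ℝ) :
    IntegrableOn (fun x => k + a * (ξ + hess φ x) 0 0 + b * (ξ + hess φ x) 0 1
      + c * (ξ + hess φ x) 1 0 + d * (ξ + hess φ x) 1 1 + e * (ξ + hess φ x).det) symSquare ∧
    ∫ x in symSquare, (k + a * (ξ + hess φ x) 0 0 + b * (ξ + hess φ x) 0 1
      + c * (ξ + hess φ x) 1 0 + d * (ξ + hess φ x) 1 1 + e * (ξ + hess φ x).det) =
    k + a * ξ 0 0 + b * ξ 0 1 + c * ξ 1 0 + d * ξ 1 1 + e * ξ.det := by
  have i00 := hφ.integrableOn_hess 0 0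
  have i01 := hφ.integrableOn_hess 0 1
  have i10 := hφ.integrableOn_hess 1 0
  have i11 := hφ.integrableOn_hess 1 1
  have j1 := hφ.integrableOn_hess_mul 0 0 1 1
  have j2 := hφ.integrableOn_hess_mul 0 1 1 0
  have hexp : ∀ x, k + a * (ξ + hess φ x) 0 0 + b * (ξ + hess φ x) 0 1
      + c * (ξ + hess φ x) 1 0 + d * (ξ + hess φ x) 1 1 + e * (ξ + hess φ x).det =
      (k + a * ξ 0 0 + b * ξ 0 1 + c * ξ 1 0 + d * ξ 1 1 + e * ξ.det)
      + ((a + e * ξ 1 1) * hess φ x 0 0 + (b - e * ξ 1 0) * hess φ x 0 1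
      + (c - e * ξ 0 1) * hess φ x 1 0 + (d + e * ξ 0 0) * hess φ x 1 1
      + e * (hess φ x 0 0 * hess φ x 1 1 - hess φ x 0 1 * hess φ x 1 0)) := by
    intro x
    simp only [Matrix.det_fin_two, Matrix.add_apply]
    ring
  simp_rw [hexp]
  have haff := integral_affine_combination i00 i01 i10 i11 (j1.sub j2)
    (k + a * ξ 0 0 + b * ξ 0 1 + c * ξ 1 0 + d * ξ 1 1 + e * ξ.det)
    (a + e * ξ 1 1) (b - e * ξ 1 0) (c - e * ξ 0 1) (d + e * ξ 0 0) e
  refine ⟨haff.1, haff.2.trans ?_⟩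
  have hj : ∫ x in symSquare, ((fun x => hess φ x 0 0 * hess φ x 1 1) -
      fun x => hess φ x 0 1 * hess φ x 1 0) x = 0 := by
    rw [integral_sub' j1 j2, hφ.setIntegral_hess_mul, sub_self]
  rw [hj, hφ.setIntegral_hess, hφ.setIntegral_hess, hφ.setIntegral_hess, hφ.setIntegral_hess]
  simp [Measure.real, volume_symSquare]

end MemW2inf0

/-- The indefinite integral of a bounded measurable periodic function of mean zero is Lipschitz
and periodic. -/
theorem periodic_integral_of_mean_zero {h : ℝ → ℝ} {T C : ℝ} (hC : ∀ y, |h y| ≤ C)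
    (hm : Measurable h) (hp : Function.Periodic h T) (t₀ : ℝ)
    (h0 : ∫ y in t₀..(t₀ + T), h y = 0) :
    Function.Periodic (fun y => ∫ z in (0)..y, h z) T ∧
      LipschitzWith C.toNNReal (fun y => ∫ z in (0)..y, h z) := by
  have hC0 : 0 ≤ C := (abs_nonneg _).trans (hC 0)
  have hi : ∀ a b, IntervalIntegrable h volume a b := fun a b => by
    refine (intervalIntegrable_const (c := C)).mono_fun hm.aestronglyMeasurable ?_
    refine Eventually.of_forall fun y => ?_
    simpa [abs_of_nonneg hC0] using hC y
  constructor
  · intro y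
    change ∫ z in (0)..(y + T), h z = ∫ z in (0)..y, h z
    rw [← intervalIntegral.integral_add_adjacent_intervals (hi 0 y) (hi y (y + T)),
      hp.intervalIntegral_add_eq y t₀, h0, add_zero]
  · refine LipschitzWith.of_dist_le_mul fun x y => ?_
    rw [Real.dist_eq, Real.dist_eq, intervalIntegral.integral_interval_sub_left (hi 0 x) (hi 0 y),
      Real.coe_toNNReal _ hC0]
    rw [← Real.norm_eq_abs]
    exact intervalIntegral.norm_integral_le_of_norm_le_const fun z _ => hC z

/-- A two-valued square wave of mean zero has a periodic second primitive. -/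
theorem exists_second_primitive {v₁ v₂ : ℝ} (hv : v₂ ≠ 0) (hv' : v₁ * v₂ ≤ 0) :
    ∃ (w : ℝ) (g g' : ℝ → ℝ) (K : NNReal) (M : ℝ), (∀ y, HasDerivAt g (g' y) y) ∧
      LipschitzWith K g' ∧ (∀ y, |g y| ≤ M) ∧ (∀ y, |g' y| ≤ M) ∧
      (∀ y, cos w < cos y → HasDerivAt g' v₁ y) ∧ ∀ y, cos y < cos w → HasDerivAt g' v₂ y := by
  have hv2 : 0 < v₂ ^ 2 := by positivity
  have hd : v₂ - v₁ ≠ 0 := by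
    intro h
    nlinarith [show v₂ * (v₂ - v₁) = 0 by rw [h, mul_zero]]
  set w := π * (v₂ / (v₂ - v₁)) with hw
  have hfrac : v₂ / (v₂ - v₁) = v₂ ^ 2 / (v₂ ^ 2 - v₁ * v₂) := by
    rw [show v₂ ^ 2 - v₁ * v₂ = v₂ * (v₂ - v₁) by ring]
    field_simp
  have hw0 : 0 ≤ w := by
    rw [hw, hfrac]
    exact mul_nonneg pi_pos.le (div_nonneg hv2.le (by linarith))
  have hwπ : w ≤ π := by
    rw [hw, hfrac]
    exact mul_le_of_le_one_right pi_pos.le ((div_le_one (by linarith)).2 (by linarith))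
  have hwv : w * v₁ + (π - w) * v₂ = 0 := by
    rw [hw]; field_simp; ring
  set h : ℝ → ℝ := fun y => if cos w < cos y then v₁ else v₂ with hh
  have hm : Measurable h :=
    Measurable.ite (measurableSet_lt measurable_const measurable_cos) measurable_const
      measurable_const
  have hC : ∀ y, |h y| ≤ max |v₁| |v₂| := by
    intro y
    simp only [hh]
    split_ifs
    · exact le_max_left _ _
    · exact le_max_right _ _
  have hp : Function.Periodic h (2 * π) := by
    intro y; simp only [hh, cos_add_two_pi]
  have hi : ∀ a b, IntervalIntegrable h volume a b := fun a b => by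
    refine (intervalIntegrable_const (c := max |v₁| |v₂|)).mono_fun hm.aestronglyMeasurable ?_
    refine Eventually.of_forall fun y => ?_
    simpa [abs_of_nonneg ((abs_nonneg _).trans (hC 0))] using hC y
  have h0 : ∫ y in (-π)..(-π + 2 * π), h y = 0 := by
    rw [show -π + 2 * π = π by ring,
      ← intervalIntegral.integral_add_adjacent_intervals (hi (-π) (-w)) (hi (-w) π),
      ← intervalIntegral.integral_add_adjacent_intervals (hi (-w) w) (hi w π)]
    have e1 : ∫ y in (-π)..(-w), h y = ∫ y in (-π)..(-w), v₂ := by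
      refine intervalIntegral.integral_congr_Ioo_of_le (by linarith) fun y hy => ?_
      simp only [hh]
      rw [if_neg]
      rw [not_lt, ← cos_neg y]
      exact cos_le_cos_of_nonneg_of_le_pi hw0 (by linarith [hy.1]) (by linarith [hy.2])
    have e2 : ∫ y in (-w)..w, h y = ∫ y in (-w)..w, v₁ := by
      refine intervalIntegral.integral_congr_Ioo_of_le (by linarith) fun y hy => ?_
      simp only [hh]
      rw [if_pos]
      rw [← cos_abs y]
      exact cos_lt_cos_of_nonneg_of_le_pi (abs_nonneg _) hwπ (abs_lt.2 hy)
    have e3 : ∫ y in w..π, h y = ∫ y in w..π, v₂ := by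
      refine intervalIntegral.integral_congr_Ioo_of_le hwπ fun y hy => ?_
      simp only [hh]
      rw [if_neg]
      rw [not_lt]
      exact cos_le_cos_of_nonneg_of_le_pi hw0 hy.2.le hy.1.le
    rw [e1, e2, e3]
    simp only [intervalIntegral.integral_const, smul_eq_mul]
    linarith
  obtain ⟨hHp, hHl⟩ := periodic_integral_of_mean_zero hC hm hp (-π) h0
  set H : ℝ → ℝ := fun y => ∫ z in (0)..y, h z with hH
  set c : ℝ := (∫ y in (0)..(0 + 2 * π), H y) / (2 * π) with hc
  have hg'l : LipschitzWith (max |v₁| |v₂|).toNNReal (fun y => H y - c) := by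
    refine LipschitzWith.of_dist_le_mul fun x y => ?_
    rw [dist_sub_right]; exact hHl.dist_le_mul x y
  have hg'p : Function.Periodic (fun y => H y - c) (2 * π) := fun y => by
    simp only [hHp y]
  have h2π : (2 * π) ≠ 0 := by positivity
  obtain ⟨M₁, hM₁⟩ := (hg'p.isBounded_of_continuous h2π hg'l.continuous).exists_norm_le
  have hM₁' : ∀ y, |H y - c| ≤ M₁ := fun y => hM₁ _ (mem_range_self y)
  have hmean : ∫ y in (0)..(0 + 2 * π), (H y - c) = 0 := by
    rw [intervalIntegral.integral_sub (hHl.continuous.intervalIntegrable _ _)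
      intervalIntegrable_const, intervalIntegral.integral_const, hc]
    simp only [smul_eq_mul]
    field_simp
    ring
  obtain ⟨hGp, hGl⟩ :=
    periodic_integral_of_mean_zero hM₁' hg'l.continuous.measurable hg'p 0 hmean
  obtain ⟨M₂, hM₂⟩ := (hGp.isBounded_of_continuous h2π hGl.continuous).exists_norm_le
  have hderiv : ∀ y v, h =ᶠ[𝓝 y] (fun _ => v) → HasDerivAt (fun y => H y - c) v y := by
    intro y v hyv
    have hcont : ContinuousAt h y := continuousAt_const.congr hyv.symm
    have := intervalIntegral.integral_hasDerivAt_right (hi 0 y)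
      hm.stronglyMeasurable.stronglyMeasurableAtFilter hcont
    rw [hyv.eq_of_nhds] at this
    exact this.sub_const c
  refine ⟨w, fun y => ∫ z in (0)..y, (H z - c), fun y => H y - c, _, max M₁ M₂, ?_, hg'l, ?_, ?_,
    ?_, ?_⟩
  · intro y
    exact intervalIntegral.integral_hasDerivAt_right (hg'l.continuous.intervalIntegrable _ _)
      hg'l.continuous.stronglyMeasurable.stronglyMeasurableAtFilter hg'l.continuous.continuousAt
  · exact fun y => (hM₂ _ (mem_range_self y)).trans (le_max_right _ _)
  · exact fun y => (hM₁' y).trans (le_max_left _ _)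
  · intro y hy
    refine hderiv y v₁ ?_
    filter_upwards [continuous_cos.continuousAt.eventually_const_lt hy] with z hz
    simp only [hh, if_pos hz]
  · intro y hy
    refine hderiv y v₂ ?_
    filter_upwards [continuous_cos.continuousAt.eventually_lt_const hy] with z hz
    simp only [hh, if_neg hz.not_gt]

theorem lipschitz_smul_of_bounded {X V : Type*} [PseudoMetricSpace X] [NormedAddCommGroup V]
    [NormedSpace ℝ V] {f : X → ℝ} {F : X → V} {K L : NNReal} (hf : LipschitzWith K f)
    (hF : LipschitzWith L F) {a b : ℝ} (ha : ∀ x, |f x| ≤ a) (hb : ∀ x, ‖F x‖ ≤ b) :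
    ∃ C, LipschitzWith C fun x => f x • F x := by
  refine ⟨(a * L + K * b).toNNReal, LipschitzWith.of_dist_le_mul fun x y => ?_⟩
  have ha0 : 0 ≤ a := (abs_nonneg _).trans (ha x)
  have hb0 : 0 ≤ b := (norm_nonneg _).trans (hb x)
  rw [Real.coe_toNNReal _ (by positivity), dist_eq_norm,
    show f x • F x - f y • F y = f x • (F x - F y) + (f x - f y) • F y by
      rw [smul_sub, sub_smul]; abel]
  refine (norm_add_le _ _).trans ?_
  rw [norm_smul, norm_smul, Real.norm_eq_abs, ← dist_eq_norm, ← dist_eq_norm]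
  have h1 : |f x| * dist (F x) (F y) ≤ a * (L * dist x y) :=
    mul_le_mul (ha x) (hF.dist_le_mul x y) dist_nonneg ha0
  have h2 : dist (f x) (f y) * ‖F y‖ ≤ (K * dist x y) * b :=
    mul_le_mul (hf.dist_le_mul x y) (hb y) (norm_nonneg _) (by positivity)
  linarith

theorem exists_bound_of_hasCompactSupport {X V : Type*} [TopologicalSpace X]
    [NormedAddCommGroup V] {F : X → V} (hF : Continuous F) (hc : HasCompactSupport F) :
    ∃ b, ∀ x, ‖F x‖ ≤ b :=
  hc.exists_bound_of_continuous hF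

/-- High-frequency modulation of a smooth amplitude supported in the open square: the Hessian is,
up to a small error, the rank-one profile, and the error vanishes where the amplitude is locally
constant. -/
theorem exists_modulation {A : (Fin 2 → ℝ) → ℝ} (hA : ContDiff ℝ 2 A)
    (hsupp : tsupport A ⊆ interior symSquare) (l : (Fin 2 → ℝ) →L[ℝ] ℝ)
    {g g' : ℝ → ℝ} {K : NNReal} {M : ℝ} (hg : ∀ y, HasDerivAt g (g' y) y)
    (hg'l : LipschitzWith K g') (hgM : ∀ y, |g y| ≤ M) (hg'M : ∀ y, |g' y| ≤ M)
    {ε : ℝ} (hε : 0 < ε) :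
    ∃ m : ℝ, 0 < m ∧ ∃ φ, MemW2inf0 φ ∧ ∀ x d, HasDerivAt g' d (m * l x) → ∀ i j,
      |hess φ x i j - A x * d * l (Pi.single i 1) * l (Pi.single j 1)| ≤ ε ∧
      ((∃ c, A =ᶠ[𝓝 x] fun _ => c) →
        hess φ x i j = A x * d * l (Pi.single i 1) * l (Pi.single j 1)) := by
  have hcA : HasCompactSupport A :=
    isCompact_symSquare.of_isClosed_subset (isClosed_tsupport A) (hsupp.trans interior_subset)
  have hA1 : ContDiff ℝ 1 (fderiv ℝ A) := hA.fderiv_right (by norm_num)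
  have hA2 : ContDiff ℝ 0 (fderiv ℝ (fderiv ℝ A)) := hA1.fderiv_right (by norm_num)
  obtain ⟨B₀, hB₀⟩ := exists_bound_of_hasCompactSupport hA.continuous hcA
  obtain ⟨B₁, hB₁⟩ := exists_bound_of_hasCompactSupport hA1.continuous (hcA.fderiv ℝ)
  obtain ⟨B₂, hB₂⟩ := exists_bound_of_hasCompactSupport hA2.continuous ((hcA.fderiv ℝ).fderiv ℝ)
  obtain ⟨C₀, hC₀⟩ := (hA.of_le (by norm_num)).lipschitzWith_of_hasCompactSupport hcA
    (one_ne_zero)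
  obtain ⟨C₁, hC₁⟩ := hA1.lipschitzWith_of_hasCompactSupport (hcA.fderiv ℝ) one_ne_zero
  have hM0 : 0 ≤ M := (abs_nonneg _).trans (hgM 0)
  have hB1 : 0 ≤ B₁ := (norm_nonneg _).trans (hB₁ 0)
  have hB2 : 0 ≤ B₂ :=
    (norm_nonneg (fderiv ℝ (fderiv ℝ A) (0 : Fin 2 → ℝ))).trans (hB₂ 0)
  set R : ℝ := M * (2 * B₁ * ‖l‖ + B₂) with hR
  have hR0 : 0 ≤ R := by positivity
  set m : ℝ := 1 + R / ε with hm
  have hm1 : 1 ≤ m := by rw [hm]; linarith [div_nonneg hR0 hε.le]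
  have hm0 : 0 < m := by linarith
  have hmR : m⁻¹ * R ≤ ε := by
    rw [inv_mul_le_iff₀ hm0, hm, add_mul, div_mul_cancel₀ _ hε.ne']
    linarith
  have hgl : LipschitzWith M.toNNReal g :=
    lipschitzWith_of_nnnorm_deriv_le (fun y => (hg y).differentiableAt) fun y => by
      rw [← NNReal.coe_le_coe, Real.coe_toNNReal _ hM0, (hg y).deriv]
      exact hg'M y
  have hgc : ∀ x, HasFDerivAt (fun x => g (m * l x)) ((g' (m * l x) * m) • l) x := by
    intro x
    have := (hg (m * l x)).comp_hasFDerivAt x (l.hasFDerivAt.const_mul m)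
    rwa [smul_smul] at this
  set φ : (Fin 2 → ℝ) → ℝ := fun x => A x * (m⁻¹ ^ 2 * g (m * l x)) with hφ
  set Dφ : (Fin 2 → ℝ) → (Fin 2 → ℝ) →L[ℝ] ℝ := fun x =>
    (A x • (m⁻¹ * g' (m * l x))) • l + (m⁻¹ ^ 2 * g (m * l x)) • fderiv ℝ A x with hDφ
  have hder : ∀ x, HasFDerivAt φ (Dφ x) x := by
    intro x
    have h1 := (hA.differentiable (by norm_num) x).hasFDerivAt.mul ((hgc x).const_mul (m⁻¹ ^ 2))
    refine h1.congr_fderiv ?_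
    rw [hDφ]
    simp only [smul_smul, smul_eq_mul]
    congr 2
    field_simp
  have hfd : fderiv ℝ φ = Dφ := funext fun x => (hder x).fderiv
  have hml : LipschitzWith _ fun x => m * l x := (lipschitzWith_smul m).comp l.lipschitz
  have hLip : ∃ K, LipschitzWith K Dφ := by
    have h1 : LipschitzWith _ fun x => m⁻¹ * g' (m * l x) :=
      (lipschitzWith_smul (m⁻¹)).comp (hg'l.comp hml)
    have h2 : LipschitzWith _ fun x => m⁻¹ ^ 2 * g (m * l x) :=
      (lipschitzWith_smul (m⁻¹ ^ 2)).comp (hgl.comp hml)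
    have b1 : ∀ x, ‖m⁻¹ * g' (m * l x)‖ ≤ m⁻¹ * M := fun x => by
      rw [Real.norm_eq_abs, abs_mul, abs_of_pos (inv_pos.2 hm0)]
      exact mul_le_mul_of_nonneg_left (hg'M _) (inv_pos.2 hm0).le
    have b2 : ∀ x, |m⁻¹ ^ 2 * g (m * l x)| ≤ m⁻¹ ^ 2 * M := fun x => by
      rw [abs_mul, abs_of_pos (pow_pos (inv_pos.2 hm0) 2)]
      exact mul_le_mul_of_nonneg_left (hgM _) (pow_pos (inv_pos.2 hm0) 2).le
    obtain ⟨k1, hk1⟩ := lipschitz_smul_of_bounded hC₀ h1 hB₀ b1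
    obtain ⟨k2, hk2⟩ := lipschitz_smul_of_bounded h2 hC₁ b2 hB₁
    have h3 : LipschitzWith _ fun x => (A x • (m⁻¹ * g' (m * l x))) • l :=
      ((ContinuousLinearMap.id ℝ ℝ).smulRight l).lipschitz.comp hk1
    exact ⟨_, h3.add hk2⟩
  have hvan : ∀ x, x ∉ tsupport A → φ x = 0 ∧ Dφ x = 0 := by
    intro x hx
    have h0 : A x = 0 := image_eq_zero_of_notMem_tsupport hx
    have h1 : fderiv ℝ A x = 0 :=
      image_eq_zero_of_notMem_tsupport fun h => hx (tsupport_fderiv_subset ℝ h)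
    simp [hφ, hDφ, h0, h1]
  refine ⟨m, hm0, φ, ⟨?_, ?_, ?_⟩, ?_⟩
  · rw [contDiff_one_iff_fderiv, hfd]
    exact ⟨fun x => (hder x).differentiableAt, hLip.choose_spec.continuous⟩
  · rw [hfd]; exact hLip
  · intro x hx
    rw [hfd]
    exact hvan x fun h => hx.2 (hsupp h)
  intro x d hd i j
  have hd2 : HasFDerivAt (fderiv ℝ A) (fderiv ℝ (fderiv ℝ A) x) x :=
    (hA1.differentiable (by norm_num) x).hasFDerivAt
  have hdA : HasFDerivAt A (fderiv ℝ A x) x := (hA.differentiable (by norm_num) x).hasFDerivAt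
  have hAj : HasFDerivAt (fun y => fderiv ℝ A y (Pi.single j 1))
      ((fderiv ℝ (fderiv ℝ A) x).flip (Pi.single j 1)) x :=
    (ContinuousLinearMap.apply ℝ ℝ (Pi.single j 1 : Fin 2 → ℝ)).hasFDerivAt.comp x hd2
  have hgd : HasFDerivAt (fun x => g' (m * l x)) ((d * m) • l) x := by
    have := hd.comp_hasFDerivAt x (l.hasFDerivAt.const_mul m)
    rwa [smul_smul] at this
  have hmain : hess φ x i j = A x * d * l (Pi.single i 1) * l (Pi.single j 1) +
      (m⁻¹ * g' (m * l x) * (fderiv ℝ A x (Pi.single i 1) * l (Pi.single j 1) +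
        l (Pi.single i 1) * fderiv ℝ A x (Pi.single j 1)) +
        m⁻¹ ^ 2 * g (m * l x) * fderiv ℝ (fderiv ℝ A) x (Pi.single i 1) (Pi.single j 1)) := by
    have hfun : (fun y => fderiv ℝ φ y (Pi.single j 1)) = fun y =>
        A y * (m⁻¹ * g' (m * l y)) * l (Pi.single j 1) +
          m⁻¹ ^ 2 * g (m * l y) * fderiv ℝ A y (Pi.single j 1) := by
      funext y; rw [hfd]; simp [hDφ]
    have h1 := ((hdA.mul (hgd.const_mul m⁻¹)).mul_const (l (Pi.single j 1))).add
      (((hgc x).const_mul (m⁻¹ ^ 2)).mul hAj)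
    change fderiv ℝ (fun y => fderiv ℝ φ y (Pi.single j 1)) x (Pi.single i 1) = _
    rw [hfun]
    erw [h1.fderiv]
    simp
    field_simp
    ring
  have hn : ∀ i : Fin 2, ‖(Pi.single i 1 : Fin 2 → ℝ)‖ = 1 := fun i => by simp [Pi.norm_single]
  refine ⟨?_, ?_⟩
  · rw [hmain, add_sub_cancel_left]
    have e1 : ∀ i, |l (Pi.single i 1)| ≤ ‖l‖ := fun i => by
      have := l.le_opNorm (Pi.single i 1); rwa [hn, mul_one] at this
    have e2 : ∀ i, |fderiv ℝ A x (Pi.single i 1)| ≤ B₁ := fun i => by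
      have := (fderiv ℝ A x).le_opNorm (Pi.single i 1)
      rw [hn, mul_one] at this; exact this.trans (hB₁ x)
    have e3 : |fderiv ℝ (fderiv ℝ A) x (Pi.single i 1) (Pi.single j 1)| ≤ B₂ := by
      have := (fderiv ℝ (fderiv ℝ A) x).le_opNorm₂ (Pi.single i 1) (Pi.single j 1)
      rw [hn, hn, mul_one, mul_one] at this; exact this.trans (hB₂ x)
    have hmi : 0 < m⁻¹ := inv_pos.2 hm0
    have hmi1 : m⁻¹ ≤ 1 := inv_le_one_of_one_le₀ hm1
    have f1 : |fderiv ℝ A x (Pi.single i 1) * l (Pi.single j 1) +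
        l (Pi.single i 1) * fderiv ℝ A x (Pi.single j 1)| ≤ 2 * B₁ * ‖l‖ := by
      refine (abs_add_le _ _).trans ?_
      rw [abs_mul, abs_mul]
      have := mul_le_mul (e2 i) (e1 j) (abs_nonneg _) hB1
      have := mul_le_mul (e1 i) (e2 j) (abs_nonneg _) (norm_nonneg l)
      linarith
    refine le_trans ?_ hmR
    refine (abs_add_le _ _).trans ?_
    rw [abs_mul, abs_mul, abs_mul, abs_mul, abs_of_pos hmi, abs_of_pos (pow_pos hmi 2)]
    have g1 : m⁻¹ * |g' (m * l x)| * |fderiv ℝ A x (Pi.single i 1) * l (Pi.single j 1) +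
        l (Pi.single i 1) * fderiv ℝ A x (Pi.single j 1)| ≤ m⁻¹ * M * (2 * B₁ * ‖l‖) :=
      mul_le_mul (mul_le_mul_of_nonneg_left (hg'M _) hmi.le) f1 (abs_nonneg _) (by positivity)
    have g2 : m⁻¹ ^ 2 * |g (m * l x)| *
        |fderiv ℝ (fderiv ℝ A) x (Pi.single i 1) (Pi.single j 1)| ≤ m⁻¹ * M * B₂ := by
      refine mul_le_mul ?_ e3 (abs_nonneg _) (by positivity)
      exact mul_le_mul (by nlinarith) (hgM _) (abs_nonneg _) hmi.le
    rw [hR]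
    linarith
  · rintro ⟨c, hc⟩
    have z1 : fderiv ℝ A x = 0 := by rw [hc.fderiv_eq]; simp
    have z2 : fderiv ℝ (fderiv ℝ A) x = 0 := by rw [hc.fderiv.fderiv_eq]; simp
    rw [hmain, z1, z2]
    simp

/-- Smooth cutoffs of the open square, equal to one off a set of small measure. -/
theorem exists_cutoff {ε : ℝ} (hε : 0 < ε) :
    ∃ (ψ : (Fin 2 → ℝ) → ℝ) (S : Set (Fin 2 → ℝ)), ContDiff ℝ 2 ψ ∧
      tsupport ψ ⊆ interior symSquare ∧ (∀ x, |ψ x| ≤ 1) ∧ MeasurableSet S ∧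
      volume (symSquare ∩ S) ≤ ENNReal.ofReal ε ∧
      ∀ x ∉ S, ψ =ᶠ[𝓝 x] fun _ => 1 := by
  set δ : ℝ := min (1 / 4) (ε / 4) with hδ
  have hδ0 : 0 < δ := lt_min (by norm_num) (by linarith)
  have hδ1 : δ ≤ 1 / 4 := min_le_left _ _
  have hδ2 : δ ≤ ε / 4 := min_le_right _ _
  let f : ContDiffBump (0 : Fin 2 → ℝ) :=
    ⟨1 / 2 - δ, 1 / 2 - δ / 2, by linarith, by linarith⟩
  refine ⟨f, (Metric.ball 0 (1 / 2 - δ))ᶜ, f.contDiff, ?_, ?_,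
    Metric.isOpen_ball.measurableSet.compl,
    ?_, ?_⟩
  · rw [f.tsupport_eq, symSquare_eq_closedBall, interior_closedBall _ (by norm_num)]
    exact Metric.closedBall_subset_ball (by change 1 / 2 - δ / 2 < 1 / 2; linarith)
  · intro x
    rw [abs_of_nonneg f.nonneg]; exact f.le_one
  · rw [← sdiff_eq, measure_sdiff, volume_symSquare, Real.volume_pi_ball _ (by linarith)]
    · rw [← ENNReal.ofReal_one, ← ENNReal.ofReal_sub _ (by rw [Fintype.card_fin]; positivity)]
      apply ENNReal.ofReal_le_ofReal
      simp only [Fintype.card_fin]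
      nlinarith
    · rw [symSquare_eq_closedBall]
      exact Metric.ball_subset_closedBall.trans (Metric.closedBall_subset_closedBall (by linarith))
    · exact Metric.isOpen_ball.measurableSet.nullMeasurableSet
    · exact measure_ball_lt_top.ne
  · intro x hx
    rw [notMem_compl_iff] at hx
    filter_upwards [Metric.isOpen_ball.mem_nhds hx] with y hy
    exact f.one_of_mem_closedBall (Metric.ball_subset_closedBall hy)

theorem volume_setOf_eq_const {l : (Fin 2 → ℝ) →L[ℝ] ℝ} (hl : l ≠ 0) (c : ℝ) :
    volume {x | l x = c} = 0 := by
  obtain ⟨v, hv⟩ : ∃ v, l v ≠ 0 := by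
    by_contra! h
    exact hl (ContinuousLinearMap.ext h)
  have hne : l.toLinearMap.ker ≠ ⊤ := by
    intro h
    have : v ∈ l.toLinearMap.ker := h ▸ Submodule.mem_top
    exact hv this
  have h0 := Measure.addHaar_submodule (volume : Measure (Fin 2 → ℝ)) _ hne
  have hset : {x | l x = c} =
      (fun x => x + -((c / l v) • v)) ⁻¹' (l.toLinearMap.ker : Set (Fin 2 → ℝ)) := by
    ext x
    simp only [mem_ofPred_eq, mem_preimage, SetLike.mem_coe, LinearMap.mem_ker,
      ContinuousLinearMap.coe_coe, map_add, map_neg, map_smul, smul_eq_mul,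
      div_mul_cancel₀ _ hv]
    constructor <;> intro h <;> linarith
  rw [hset, measure_preimage_add_right, h0]

theorem volume_setOf_cos_eq {l : (Fin 2 → ℝ) →L[ℝ] ℝ} (hl : l ≠ 0) {m : ℝ} (hm : m ≠ 0) (w : ℝ) :
    volume {x | cos (m * l x) = cos w} = 0 := by
  have hsub : {x | cos (m * l x) = cos w} ⊆
      (⋃ k : ℤ, {x | l x = (2 * k * π + w) / m}) ∪ ⋃ k : ℤ, {x | l x = (2 * k * π - w) / m} := by
    intro x hx
    obtain ⟨k, hk⟩ := cos_eq_cos_iff.1 (Eq.symm hx)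
    rcases hk with hk | hk
    · left; refine mem_iUnion.2 ⟨k, ?_⟩
      rw [mem_ofPred_eq, ← hk]; field_simp
    · right; refine mem_iUnion.2 ⟨k, ?_⟩
      rw [mem_ofPred_eq, ← hk]; field_simp
  refine measure_mono_null hsub (measure_union_null ?_ ?_) <;>
    exact measure_iUnion_null fun k => volume_setOf_eq_const hl _

theorem exists_thin_layer {l : (Fin 2 → ℝ) →L[ℝ] ℝ} (hl : l ≠ 0) {m : ℝ} (hm : m ≠ 0) (w : ℝ)
    {ε : ℝ} (hε : 0 < ε) :
    ∃ δ : ℝ, 0 < δ ∧ volume (symSquare ∩ {x | cos w ≤ cos (m * l x) ∧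
      cos (m * l x) ≤ cos w + δ}) ≤ ENNReal.ofReal ε := by
  have hcont : Continuous fun x => cos (m * l x) := by fun_prop
  set s : ℕ → Set (Fin 2 → ℝ) := fun n => symSquare ∩ {x | cos w ≤ cos (m * l x) ∧
      cos (m * l x) ≤ cos w + 1 / ((n : ℝ) + 1)} with hs
  have hmeas : ∀ n, NullMeasurableSet (s n) := fun n =>
    (measurableSet_symSquare.inter ((isClosed_le continuous_const hcont).inter
      (isClosed_le hcont continuous_const)).measurableSet).nullMeasurableSet
  have hanti : Antitone s := by
    intro a b hab x hx
    refine ⟨hx.1, hx.2.1, hx.2.2.trans ?_⟩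
    have := Nat.one_div_le_one_div (α := ℝ) hab
    linarith
  have hlim := tendsto_measure_iInter_atTop (μ := volume) hmeas hanti
    ⟨0, ((measure_mono inter_subset_left).trans_lt
      (by rw [volume_symSquare]; exact ENNReal.one_lt_top)).ne⟩
  have hnull : volume (⋂ n, s n) = 0 := by
    refine measure_mono_null ?_ (volume_setOf_cos_eq hl hm w)
    intro x hx
    rw [mem_iInter] at hx
    refine le_antisymm ?_ (hx 0).2.1
    refine le_of_forall_pos_le_add fun e he => ?_
    obtain ⟨n, hn⟩ := exists_nat_one_div_lt he
    linarith [(hx n).2.2]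
  rw [hnull] at hlim
  obtain ⟨n, hn⟩ := (hlim.eventually (ge_mem_nhds (ENNReal.ofReal_pos.2 hε))).exists
  exact ⟨1 / ((n : ℝ) + 1), by positivity, hn⟩

/-- The matrix `p n ⊗ n + r n⊥ ⊗ n⊥`, where `n = (c, d)`. -/
def rankOneSum (c d p r : ℝ) : Matrix (Fin 2) (Fin 2) ℝ :=
  !![p * c ^ 2 + r * d ^ 2, (p - r) * (c * d); (p - r) * (c * d), p * d ^ 2 + r * c ^ 2]

/-- The null Lagrangian supporting `Flam` from below at a matrix diagonal in the frame of `(c, d)`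
with eigenvalue signs `e₁, e₂`. -/
def supportLagrangian (k τ c d e₁ e₂ : ℝ) (η : Matrix (Fin 2) (Fin 2) ℝ) : ℝ :=
  k + (2 * τ * (e₁ * c ^ 2 + e₂ * d ^ 2)) * η 0 0 + (2 * τ * ((e₁ - e₂) * (c * d))) * η 0 1
    + (2 * τ * ((e₁ - e₂) * (c * d))) * η 1 0 + (2 * τ * (e₁ * d ^ 2 + e₂ * c ^ 2)) * η 1 1
    + (-2 * (e₁ * e₂)) * η.det

theorem supportLagrangian_rankOneSum {c d : ℝ} (hcd : c ^ 2 + d ^ 2 = 1) (k τ e₁ e₂ p r : ℝ) :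
    supportLagrangian k τ c d e₁ e₂ (rankOneSum c d p r) =
      k + 2 * τ * (e₁ * p + e₂ * r) - 2 * (e₁ * e₂) * (p * r) := by
  have hd : d ^ 2 = 1 - c ^ 2 := by linarith
  have hd4 : d ^ 4 = (1 - c ^ 2) ^ 2 := by rw [← hd]; ring
  simp only [supportLagrangian, rankOneSum, Matrix.det_fin_two, Matrix.of_apply, Matrix.cons_val',
    Matrix.cons_val_zero, Matrix.cons_val_one, Matrix.cons_val_fin_one]
  ring_nf
  simp only [hd, hd4]
  ring

theorem sum_sq_rankOneSum {c d : ℝ} (hcd : c ^ 2 + d ^ 2 = 1) (p r : ℝ) :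
    ∑ i, ∑ j, (rankOneSum c d p r i j) ^ 2 = p ^ 2 + r ^ 2 := by
  have hd : d ^ 2 = 1 - c ^ 2 := by linarith
  have hd4 : d ^ 4 = (1 - c ^ 2) ^ 2 := by rw [← hd]; ring
  simp only [rankOneSum, Fin.sum_univ_two, Matrix.of_apply, Matrix.cons_val',
    Matrix.cons_val_zero, Matrix.cons_val_one, Matrix.cons_val_fin_one]
  ring_nf
  simp only [hd, hd4]
  ring

theorem supportLagrangian_le_Flam {lam τ c d e₁ e₂ : ℝ} (hcd : c ^ 2 + d ^ 2 = 1)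
    (hτ : lam ≤ τ ^ 2) (h₁ : e₁ = 1 ∨ e₁ = -1) (h₂ : e₂ = 1 ∨ e₂ = -1)
    (η : Matrix (Fin 2) (Fin 2) ℝ) :
    supportLagrangian (lam - τ ^ 2) τ c d e₁ e₂ η ≤ Flam lam η := by
  unfold Flam
  split_ifs with h0
  · subst h0
    simp [supportLagrangian]
    linarith
  simp only [supportLagrangian, Matrix.det_fin_two, Fin.sum_univ_two]
  have hd : d ^ 2 = 1 - c ^ 2 := by linarith
  have hN : (c ^ 2 - d ^ 2) ^ 2 + (2 * (c * d)) ^ 2 = 1 := by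
    have : (c ^ 2 + d ^ 2) ^ 2 = 1 := by rw [hcd]; norm_num
    linarith
  set C := c ^ 2 - d ^ 2
  set D := 2 * (c * d)
  have hX : ∀ X Y : ℝ, X ^ 2 + Y ^ 2 = (C * X + D * Y) ^ 2 + (D * X - C * Y) ^ 2 := by
    intro X Y
    linear_combination (-(X ^ 2 + Y ^ 2)) * hN
  have hc2 : c ^ 2 = (1 + C) / 2 := by simp only [C]; linarith
  have hd2 : d ^ 2 = (1 - C) / 2 := by simp only [C]; linarith
  have hcd2 : c * d = D / 2 := by simp only [D]; ring
  rw [hc2, hd2, hcd2]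
  have k1 := hX (η 0 0 - η 1 1) (η 0 1 + η 1 0)
  rcases h₁ with rfl | rfl <;> rcases h₂ with rfl | rfl
  · nlinarith [sq_nonneg (η 0 0 + η 1 1 - τ), sq_nonneg (η 0 1 - η 1 0)]
  · nlinarith [sq_nonneg (C * (η 0 0 - η 1 1) + D * (η 0 1 + η 1 0) - τ),
      sq_nonneg (D * (η 0 0 - η 1 1) - C * (η 0 1 + η 1 0))]
  · nlinarith [sq_nonneg (C * (η 0 0 - η 1 1) + D * (η 0 1 + η 1 0) + τ),
      sq_nonneg (D * (η 0 0 - η 1 1) - C * (η 0 1 + η 1 0))]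
  · nlinarith [sq_nonneg (η 0 0 + η 1 1 + τ), sq_nonneg (η 0 1 - η 1 0)]

theorem sq_eq_one_of_sign {e : ℝ} (h : e = 1 ∨ e = -1) : e ^ 2 = 1 := by
  rcases h with rfl | rfl <;> norm_num

theorem Flam_le_supportLagrangian {lam s c d e₁ e₂ p r : ℝ} (hcd : c ^ 2 + d ^ 2 = 1)
    (hs : s ^ 2 = lam) (h₁ : e₁ = 1 ∨ e₁ = -1) (h₂ : e₂ = 1 ∨ e₂ = -1)
    (h : (p = 0 ∧ r = 0) ∨ e₁ * p + e₂ * r = s) :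
    Flam lam (rankOneSum c d p r) ≤
      supportLagrangian 0 s c d e₁ e₂ (rankOneSum c d p r) := by
  rw [supportLagrangian_rankOneSum hcd, Flam]
  split_ifs with h0
  · have hz := sum_sq_rankOneSum hcd p r
    rw [h0] at hz
    simp only [Matrix.zero_apply, Fin.sum_univ_two] at hz
    have hp : p = 0 := by nlinarith [sq_nonneg p, sq_nonneg r]
    have hr : r = 0 := by nlinarith [sq_nonneg p, sq_nonneg r]
    simp [hp, hr]
  · rw [sum_sq_rankOneSum hcd]
    rcases h with ⟨rfl, rfl⟩ | h
    · exact absurd (by ext i j; fin_cases i <;> fin_cases j <;> simp [rankOneSum]) h0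
    · have q1 := sq_eq_one_of_sign h₁
      have q2 := sq_eq_one_of_sign h₂
      have hsq : (e₁ * p + e₂ * r) ^ 2 = lam := by rw [h, hs]
      have : p ^ 2 + r ^ 2 = lam - 2 * (e₁ * e₂) * (p * r) := by
        linear_combination hsq - p ^ 2 * q1 - r ^ 2 * q2
      rw [this, h]
      nlinarith

theorem Flam_sub_supportLagrangian_bounded (lam k τ c d e₁ e₂ R : ℝ) :
    ∃ C : ℝ, 0 < C ∧ ∀ η : Matrix (Fin 2) (Fin 2) ℝ, (∀ i j, |η i j| ≤ R) →
      |Flam lam η| ≤ C ∧ Flam lam η - supportLagrangian k τ c d e₁ e₂ η ≤ C := by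
  set a₁ := 2 * τ * (e₁ * c ^ 2 + e₂ * d ^ 2) with ha₁
  set a₂ := 2 * τ * ((e₁ - e₂) * (c * d)) with ha₂
  set a₃ := 2 * τ * (e₁ * d ^ 2 + e₂ * c ^ 2) with ha₃
  set a₄ := -2 * (e₁ * e₂) with ha₄
  refine ⟨1 + |lam| + 4 * R ^ 2 + |k| + |a₁| * |R| + 2 * (|a₂| * |R|) + |a₃| * |R| +
    |a₄| * (2 * R ^ 2), by positivity, fun η hη => ?_⟩
  have hR : 0 ≤ R := (abs_nonneg _).trans (hη 0 0)
  have hF : |Flam lam η| ≤ |lam| + 4 * R ^ 2 := by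
    unfold Flam
    split_ifs
    · rw [abs_zero]; positivity
    · refine (abs_add_le _ _).trans ?_
      have hs : ∀ i j, η i j ^ 2 ≤ R ^ 2 := fun i j =>
        sq_le_sq' (abs_le.1 (hη i j)).1 (abs_le.1 (hη i j)).2
      simp only [Fin.sum_univ_two]
      refine add_le_add le_rfl ?_
      rw [abs_of_nonneg (by positivity)]
      linarith [hs 0 0, hs 0 1, hs 1 0, hs 1 1]
  have hm : ∀ (a : ℝ) i j, |a * η i j| ≤ |a| * |R| := fun a i j => by
    rw [abs_mul, abs_of_nonneg hR]
    exact mul_le_mul_of_nonneg_left (hη i j) (abs_nonneg a)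
  have hdet : |a₄ * η.det| ≤ |a₄| * (2 * R ^ 2) := by
    rw [abs_mul]
    refine mul_le_mul_of_nonneg_left ?_ (abs_nonneg _)
    rw [Matrix.det_fin_two]
    refine (abs_sub _ _).trans ?_
    rw [abs_mul, abs_mul]
    have := mul_le_mul (hη 0 0) (hη 1 1) (abs_nonneg _) hR
    have := mul_le_mul (hη 0 1) (hη 1 0) (abs_nonneg _) hR
    nlinarith
  have p1 : 0 ≤ |a₁| * |R| := by positivity
  have p2 : 0 ≤ |a₂| * |R| := by positivity
  have p3 : 0 ≤ |a₃| * |R| := by positivity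
  have p4 : 0 ≤ |a₄| * (2 * R ^ 2) := by positivity
  constructor
  · linarith [abs_nonneg k]
  · have hP : supportLagrangian k τ c d e₁ e₂ η =
      k + a₁ * η 0 0 + a₂ * η 0 1 + a₂ * η 1 0 + a₃ * η 1 1 + a₄ * η.det := rfl
    rw [hP]
    linarith [le_abs_self (Flam lam η), neg_abs_le k, (abs_le.1 (hm a₁ 0 0)).1,
      (abs_le.1 (hm a₂ 0 1)).1, (abs_le.1 (hm a₂ 1 0)).1, (abs_le.1 (hm a₃ 1 1)).1,
      (abs_le.1 hdet).1]

theorem measurable_Flam_comp (lam : ℝ) {η : (Fin 2 → ℝ) → Matrix (Fin 2) (Fin 2) ℝ}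
    (hη : ∀ i j, Measurable fun x => η x i j) : Measurable fun x => Flam lam (η x) := by
  unfold Flam
  refine Measurable.ite ?_ measurable_const ?_
  · have : {x | η x = 0} = ⋂ i, ⋂ j, {x | η x i j = 0} := by
      ext x
      simp only [mem_ofPred_eq, mem_iInter]
      exact ⟨fun h i j => by rw [h]; rfl, fun h => Matrix.ext h⟩
    rw [this]
    exact MeasurableSet.iInter fun i => MeasurableSet.iInter fun j =>
      hη i j (measurableSet_singleton 0)
  · exact measurable_const.add (Finset.measurable_sum _ fun i _ =>
      Finset.measurable_sum _ fun j _ => (hη i j).pow_const 2)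

namespace MemW2inf0

variable {φ φ' : (Fin 2 → ℝ) → ℝ}

theorem integrableOn_Flam (hφ : MemW2inf0 φ) (lam : ℝ) (ξ : Matrix (Fin 2) (Fin 2) ℝ) :
    IntegrableOn (fun x => Flam lam (ξ + hess φ x)) symSquare := by
  obtain ⟨K, hK⟩ := hφ.exists_abs_hess_le
  obtain ⟨C, -, hC⟩ := Flam_sub_supportLagrangian_bounded lam 0 0 0 0 0 0
    (|ξ 0 0| + |ξ 0 1| + |ξ 1 0| + |ξ 1 1| + K)
  refine integrableOn_symSquare_of_bounded (C := C) (measurable_Flam_comp lam fun i j =>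
    measurable_const.add (measurable_hess φ i j)) fun x => (hC _ fun i j => ?_).1
  rw [Matrix.add_apply]
  refine (abs_add_le _ _).trans (add_le_add ?_ (hK x i j))
  have := abs_nonneg (ξ 0 0); have := abs_nonneg (ξ 0 1)
  have := abs_nonneg (ξ 1 0); have := abs_nonneg (ξ 1 1)
  fin_cases i <;> fin_cases j <;> simp <;> linarith

theorem supportLagrangian_integral (hφ : MemW2inf0 φ) (ξ : Matrix (Fin 2) (Fin 2) ℝ)
    (k τ c d e₁ e₂ : ℝ) :
    IntegrableOn (fun x => supportLagrangian k τ c d e₁ e₂ (ξ + hess φ x)) symSquare ∧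
      ∫ x in symSquare, supportLagrangian k τ c d e₁ e₂ (ξ + hess φ x) =
        supportLagrangian k τ c d e₁ e₂ ξ :=
  hφ.setIntegral_nullLagrangian ξ _ _ _ _ _ _

theorem supportLagrangian_le_integral (hφ : MemW2inf0 φ) (ξ : Matrix (Fin 2) (Fin 2) ℝ)
    {lam τ c d e₁ e₂ : ℝ} (hcd : c ^ 2 + d ^ 2 = 1) (hτ : lam ≤ τ ^ 2)
    (h₁ : e₁ = 1 ∨ e₁ = -1) (h₂ : e₂ = 1 ∨ e₂ = -1) :
    supportLagrangian (lam - τ ^ 2) τ c d e₁ e₂ ξ ≤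
      ∫ x in symSquare, Flam lam (ξ + hess φ x) := by
  obtain ⟨hi, he⟩ := hφ.supportLagrangian_integral ξ (lam - τ ^ 2) τ c d e₁ e₂
  rw [← he]
  exact integral_mono hi (hφ.integrableOn_Flam lam ξ) fun x =>
    supportLagrangian_le_Flam hcd hτ h₁ h₂ _

theorem add (hφ : MemW2inf0 φ) (hφ' : MemW2inf0 φ') : MemW2inf0 fun x => φ x + φ' x := by
  obtain ⟨h1, ⟨K, hK⟩, h3⟩ := hφ
  obtain ⟨h1', ⟨K', hK'⟩, h3'⟩ := hφ'
  have hf : (fun x => fderiv ℝ (fun x => φ x + φ' x) x) = fun x => fderiv ℝ φ x + fderiv ℝ φ' x :=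
    funext fun x => fderiv_fun_add (h1.differentiable one_ne_zero x)
      (h1'.differentiable one_ne_zero x)
  refine ⟨h1.add h1', ⟨K + K', by rw [hf]; exact hK.add hK'⟩, fun x hx => ⟨?_, ?_⟩⟩
  · change φ x + φ' x = 0
    rw [(h3 x hx).1, (h3' x hx).1, add_zero]
  · rw [congrFun hf x, (h3 x hx).2, (h3' x hx).2, add_zero]

theorem hess_add_ae (hφ : MemW2inf0 φ) (hφ' : MemW2inf0 φ') :
    ∀ᵐ x, ∀ i j, hess (fun x => φ x + φ' x) x i j = hess φ x i j + hess φ' x i j := by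
  have hd : ∀ᵐ x, ∀ j : Fin 2, DifferentiableAt ℝ (fun y => fderiv ℝ φ y (Pi.single j 1)) x :=
    ae_all_iff.2 fun j => (hφ.lipschitz_partial j).1.choose_spec.ae_differentiableAt
  have hd' : ∀ᵐ x, ∀ j : Fin 2, DifferentiableAt ℝ (fun y => fderiv ℝ φ' y (Pi.single j 1)) x :=
    ae_all_iff.2 fun j => (hφ'.lipschitz_partial j).1.choose_spec.ae_differentiableAt
  filter_upwards [hd, hd'] with x hx hx' i j
  have hf : (fun y => fderiv ℝ (fun x => φ x + φ' x) y (Pi.single j 1)) =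
      fun y => fderiv ℝ φ y (Pi.single j 1) + fderiv ℝ φ' y (Pi.single j 1) := by
    funext y
    rw [fderiv_fun_add (hφ.1.differentiable one_ne_zero y) (hφ'.1.differentiable one_ne_zero y)]
    rfl
  change fderiv ℝ (fun y => fderiv ℝ (fun x => φ x + φ' x) y (Pi.single j 1)) x (Pi.single i 1) = _
  rw [hf, fderiv_fun_add (hx j) (hx' j)]
  rfl

end MemW2inf0

theorem memW2inf0_zero : MemW2inf0 fun _ => 0 :=
  ⟨contDiff_const, ⟨0, by simp⟩,
    fun x _ => by simp⟩

theorem hess_zero (x : Fin 2 → ℝ) : hess (fun _ => 0) x = 0 := by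
  ext i j
  simp [hess]

/-- A simple laminate with profile values `v₁, v₂` in the direction of `l`, cut off by an
amplitude. -/
theorem exists_laminate {A : (Fin 2 → ℝ) → ℝ} (hA : ContDiff ℝ 2 A)
    (hsupp : tsupport A ⊆ interior symSquare) (hA1 : ∀ x, |A x| ≤ 1)
    (l : (Fin 2 → ℝ) →L[ℝ] ℝ) (hl : ∀ i, |l (Pi.single i 1)| ≤ 1) {v₁ v₂ : ℝ} (hv : v₂ ≠ 0)
    (hv' : v₁ * v₂ ≤ 0) :
    ∃ w m : ℝ, m ≠ 0 ∧ ∃ φ, MemW2inf0 φ ∧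
      (∀ x, cos (m * l x) ≠ cos w → ∀ i j, |hess φ x i j| ≤ |v₁| + |v₂| + 1) ∧
      ∀ x k, A =ᶠ[𝓝 x] (fun _ => k) →
        (cos w < cos (m * l x) → ∀ i j,
          hess φ x i j = k * v₁ * l (Pi.single i 1) * l (Pi.single j 1)) ∧
        (cos (m * l x) < cos w → ∀ i j,
          hess φ x i j = k * v₂ * l (Pi.single i 1) * l (Pi.single j 1)) := by
  obtain ⟨w, g, g', K, M, hg, hg'l, hgM, hg'M, h₁, h₂⟩ := exists_second_primitive hv hv'
  obtain ⟨m, hm, φ, hφ, hmod⟩ := exists_modulation hA hsupp l hg hg'l hgM hg'M one_pos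
  refine ⟨w, m, hm.ne', φ, hφ, fun x hx i j => ?_,
    fun x k hk => ⟨fun hx i j => ?_, fun hx i j => ?_⟩⟩
  · have main : ∀ d, HasDerivAt g' d (m * l x) → |hess φ x i j| ≤ |d| + 1 := fun d hd => by
      have h := (hmod x d hd i j).1
      have hb : |A x * d * l (Pi.single i 1) * l (Pi.single j 1)| ≤ |d| := by
        rw [abs_mul, abs_mul, abs_mul]
        calc |A x| * |d| * |l (Pi.single i 1)| * |l (Pi.single j 1)| ≤ 1 * |d| * 1 * 1 := by
              gcongr
              exacts [hA1 x, hl i, hl j]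
          _ = |d| := by ring
      have := abs_add_le (hess φ x i j - A x * d * l (Pi.single i 1) * l (Pi.single j 1))
        (A x * d * l (Pi.single i 1) * l (Pi.single j 1))
      rw [sub_add_cancel] at this
      linarith
    rcases lt_or_gt_of_ne hx with h | h
    · linarith [main _ (h₂ _ h), abs_nonneg v₁]
    · linarith [main _ (h₁ _ h), abs_nonneg v₂]
  · rw [((hmod x _ (h₁ _ hx) i j).2 ⟨k, hk⟩), hk.eq_of_nhds]
  · rw [((hmod x _ (h₂ _ hx) i j).2 ⟨k, hk⟩), hk.eq_of_nhds]

/-- The linear form with coefficients `c, d`. -/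
noncomputable def planeForm (c d : ℝ) : (Fin 2 → ℝ) →L[ℝ] ℝ :=
  c • ContinuousLinearMap.proj 0 + d • ContinuousLinearMap.proj 1

theorem planeForm_single_zero (c d : ℝ) : planeForm c d (Pi.single 0 1) = c := by
  simp [planeForm]

theorem planeForm_single_one (c d : ℝ) : planeForm c d (Pi.single 1 1) = d := by
  simp [planeForm]

theorem planeForm_ne_zero {c d : ℝ} (hcd : c ^ 2 + d ^ 2 = 1) : planeForm c d ≠ 0 := by
  intro h
  have hc := planeForm_single_zero c d
  have hd := planeForm_single_one c d
  rw [h, _root_.zero_apply] at hc hd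
  rw [← hc, ← hd] at hcd
  norm_num at hcd

theorem abs_planeForm_single_le {c d : ℝ} (hcd : c ^ 2 + d ^ 2 = 1) (i : Fin 2) :
    |planeForm c d (Pi.single i 1)| ≤ 1 := by
  rw [← sq_le_one_iff_abs_le_one]
  fin_cases i
  · change planeForm c d (Pi.single 0 1) ^ 2 ≤ 1
    rw [planeForm_single_zero]; nlinarith [sq_nonneg d]
  · change planeForm c d (Pi.single 1 1) ^ 2 ≤ 1
    rw [planeForm_single_one]; nlinarith [sq_nonneg c]

/-- A cutoff localised to the layers where `cos (m * l x)` exceeds `cos w`. -/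
theorem exists_layer_cutoff {ψ : (Fin 2 → ℝ) → ℝ} (hψ : ContDiff ℝ 2 ψ)
    (hsupp : tsupport ψ ⊆ interior symSquare) (hψ1 : ∀ x, |ψ x| ≤ 1)
    (l : (Fin 2 → ℝ) →L[ℝ] ℝ) (m w : ℝ) {δ : ℝ} (hδ : 0 < δ) :
    ∃ χ : (Fin 2 → ℝ) → ℝ, ContDiff ℝ 2 χ ∧ tsupport χ ⊆ interior symSquare ∧
      (∀ x, |χ x| ≤ 1) ∧
      (∀ x, cos (m * l x) < cos w → χ =ᶠ[𝓝 x] fun _ => 0) ∧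
      ∀ x, cos w + δ < cos (m * l x) → ψ =ᶠ[𝓝 x] (fun _ => 1) → χ =ᶠ[𝓝 x] fun _ => 1 := by
  have hc : Continuous fun x => cos (m * l x) := by fun_prop
  refine ⟨fun x => ψ x * smoothTransition ((cos (m * l x) - cos w) / δ), ?_, ?_, fun x => ?_,
    fun x hx => ?_, fun x hx h1 => ?_⟩
  · have : ContDiff ℝ 2 fun x => (cos (m * l x) - cos w) / δ :=
      (((contDiff_const.mul l.contDiff).cos).sub contDiff_const).div_const δ
    exact hψ.mul (smoothTransition.contDiff.comp this)
  · exact (tsupport_mul_subset_left).trans hsupp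
  · rw [abs_mul, abs_of_nonneg (smoothTransition.nonneg _)]
    exact mul_le_one₀ (hψ1 x) (smoothTransition.nonneg _) (smoothTransition.le_one _)
  · filter_upwards [(isOpen_lt hc continuous_const).mem_nhds hx] with y hy
    rw [smoothTransition.zero_of_nonpos, mul_zero]
    exact div_nonpos_of_nonpos_of_nonneg (sub_nonpos.2 (le_of_lt hy)) hδ.le
  · filter_upwards [(isOpen_lt continuous_const hc).mem_nhds hx, h1] with y hy hy1
    rw [smoothTransition.one_of_one_le, hy1, one_mul]
    rw [one_le_div hδ]
    have : cos w + δ < cos (m * l y) := hy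
    linarith

/-- A two-stage laminate whose energy is nearly the value of the supporting null Lagrangian. -/
theorem exists_energy_le {lam s c d e₁ e₂ a b : ℝ} (hcd : c ^ 2 + d ^ 2 = 1) (hs : s ^ 2 = lam)
    (h₁ : e₁ = 1 ∨ e₁ = -1) (h₂ : e₂ = 1 ∨ e₂ = -1) (ha : e₁ * a = |a|) (hb : e₂ * b = |b|)
    (hab : |a| + |b| < s) {ε : ℝ} (hε : 0 < ε) :
    ∃ φ, MemW2inf0 φ ∧ ∫ x in symSquare, Flam lam (rankOneSum c d a b + hess φ x) ≤
      supportLagrangian 0 s c d e₁ e₂ (rankOneSum c d a b) + ε := by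
  set ξ := rankOneSum c d a b with hξ
  have hcd' : (-d) ^ 2 + c ^ 2 = 1 := by linarith
  have q₁ := sq_eq_one_of_sign h₁
  have q₂ := sq_eq_one_of_sign h₂
  have n₁ : e₁ ≠ 0 := by rintro rfl; norm_num at q₁
  have n₂ : e₂ ≠ 0 := by rintro rfl; norm_num at q₂
  have ha0 := abs_nonneg a
  have hb0 := abs_nonneg b
  set v := e₁ * (s - |a| - |b|) with hv
  set u := e₂ * (s - |b|) with hu
  have hv0 : v ≠ 0 := mul_ne_zero n₁ (by linarith)
  have hu0 : u ≠ 0 := mul_ne_zero n₂ (by linarith)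
  have hv1 : -a * v ≤ 0 := by
    have : -a * v = -(|a| * (s - |a| - |b|)) := by rw [hv, ← ha]; ring
    rw [this]; exact neg_nonpos.2 (mul_nonneg ha0 (by linarith))
  have hu1 : -b * u ≤ 0 := by
    have : -b * u = -(|b| * (s - |b|)) := by rw [hu, ← hb]; ring
    rw [this]; exact neg_nonpos.2 (mul_nonneg hb0 (by linarith))
  set R := (|ξ 0 0| + |ξ 0 1| + |ξ 1 0| + |ξ 1 1|) + (|-a| + |v| + 1) + (|-b| + |u| + 1) with hR
  obtain ⟨C, hC, hCb⟩ := Flam_sub_supportLagrangian_bounded lam 0 s c d e₁ e₂ R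
  have hε₀ : 0 < ε / (2 * C) := by positivity
  obtain ⟨ψ, S, hψ, hψs, hψ1, hSm, hSv, hψS⟩ := exists_cutoff hε₀
  obtain ⟨w, m, hm, φ, hφ, hφb, hφe⟩ := exists_laminate hψ hψs hψ1 (planeForm c d)
    (abs_planeForm_single_le hcd) hv0 hv1
  obtain ⟨δ, hδ, hδv⟩ := exists_thin_layer (planeForm_ne_zero hcd) hm w hε₀
  obtain ⟨χ, hχ, hχs, hχ1, hχ0, hχe⟩ := exists_layer_cutoff hψ hψs hψ1 (planeForm c d) m w hδ
  obtain ⟨w', m', hm', φ', hφ', hφb', hφe'⟩ := exists_laminate hχ hχs hχ1 (planeForm (-d) c)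
    (abs_planeForm_single_le hcd') hu0 hu1
  set T := {x | cos w ≤ cos (m * planeForm c d x) ∧ cos (m * planeForm c d x) ≤ cos w + δ} with hT
  have hcont : Continuous fun x => cos (m * planeForm c d x) := by fun_prop
  have hTm : MeasurableSet T := ((isClosed_le continuous_const hcont).inter
    (isClosed_le hcont continuous_const)).measurableSet
  refine ⟨fun x => φ x + φ' x, hφ.add hφ', ?_⟩
  obtain ⟨hPi, hPe⟩ := (hφ.add hφ').supportLagrangian_integral ξ 0 s c d e₁ e₂
  have hFi := (hφ.add hφ').integrableOn_Flam lam ξ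
  rw [← hPe, ← sub_le_iff_le_add', ← integral_sub hFi hPi]
  have hpt : ∀ᵐ x, Flam lam (ξ + hess (fun x => φ x + φ' x) x) -
      supportLagrangian 0 s c d e₁ e₂ (ξ + hess (fun x => φ x + φ' x) x) ≤
      (S ∪ T).indicator (fun _ => C) x := by
    have hz : ∀ᵐ x, cos (m * planeForm c d x) ≠ cos w :=
      measure_eq_zero_iff_ae_notMem.1 (volume_setOf_cos_eq (planeForm_ne_zero hcd) hm w)
    have hz' : ∀ᵐ x, cos (m' * planeForm (-d) c x) ≠ cos w' :=
      measure_eq_zero_iff_ae_notMem.1 (volume_setOf_cos_eq (planeForm_ne_zero hcd') hm' w')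
    filter_upwards [hφ.hess_add_ae hφ', hz, hz'] with x hx hx₁ hx₂
    by_cases hxS : x ∈ S ∪ T
    · rw [indicator_of_mem hxS]
      refine (hCb _ fun i j => ?_).2
      rw [Matrix.add_apply, hx]
      have k1 : |ξ i j| ≤ |ξ 0 0| + |ξ 0 1| + |ξ 1 0| + |ξ 1 1| := by
        have := abs_nonneg (ξ 0 0); have := abs_nonneg (ξ 0 1)
        have := abs_nonneg (ξ 1 0); have := abs_nonneg (ξ 1 1)
        fin_cases i <;> fin_cases j <;> simp <;> linarith
      have := abs_add_le (ξ i j) (hess φ x i j + hess φ' x i j)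
      have := abs_add_le (hess φ x i j) (hess φ' x i j)
      linarith [hφb x hx₁ i j, hφb' x hx₂ i j]
    · rw [indicator_of_notMem hxS, sub_nonpos]
      have hψx := hψS x fun h => hxS (Or.inl h)
      have key : ∀ p r : ℝ, (∀ i j, hess φ x i j + hess φ' x i j =
          p * planeForm c d (Pi.single i 1) * planeForm c d (Pi.single j 1) +
          r * planeForm (-d) c (Pi.single i 1) * planeForm (-d) c (Pi.single j 1)) →
          ((a + p = 0 ∧ b + r = 0) ∨ e₁ * (a + p) + e₂ * (b + r) = s) →
          Flam lam (ξ + hess (fun x => φ x + φ' x) x) ≤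
            supportLagrangian 0 s c d e₁ e₂ (ξ + hess (fun x => φ x + φ' x) x) := by
        intro p r hpr h
        have : ξ + hess (fun x => φ x + φ' x) x = rankOneSum c d (a + p) (b + r) := by
          ext i j
          rw [Matrix.add_apply, hx, hpr]
          fin_cases i <;> fin_cases j <;>
            simp [hξ, rankOneSum, planeForm_single_zero, planeForm_single_one] <;> ring
        rw [this]
        exact Flam_le_supportLagrangian hcd hs h₁ h₂ h
      have hev : e₁ * v = s - |a| - |b| := by rw [hv, ← mul_assoc, ← sq, q₁, one_mul]
      have heu : e₂ * u = s - |b| := by rw [hu, ← mul_assoc, ← sq, q₂, one_mul]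
      rcases lt_or_gt_of_ne hx₁ with hlt | hgt
      · refine key v 0 (fun i j => ?_) (Or.inr ?_)
        · have h0 := hφe' x 0 (hχ0 x hlt)
          rw [(hφe x 1 hψx).2 hlt i j]
          rcases lt_or_gt_of_ne hx₂ with h' | h'
          · rw [h0.2 h' i j]; ring
          · rw [h0.1 h' i j]; ring
        · linear_combination ha + hb + hev
      · have hgt' : cos w + δ < cos (m * planeForm c d x) := by
          by_contra! h
          exact hxS (Or.inr ⟨le_of_lt hgt, h⟩)
        have h0 := hφe' x 1 (hχe x hgt' hψx)
        rcases lt_or_gt_of_ne hx₂ with h' | h'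
        · refine key (-a) u (fun i j => ?_) (Or.inr ?_)
          · rw [(hφe x 1 hψx).1 hgt i j, h0.2 h' i j]; ring
          · linear_combination hb + heu
        · refine key (-a) (-b) (fun i j => ?_) (Or.inl ⟨by ring, by ring⟩)
          rw [(hφe x 1 hψx).1 hgt i j, h0.1 h' i j]; ring
  have hind : Integrable ((S ∪ T).indicator fun _ => C) (volume.restrict symSquare) :=
    (integrable_const C).indicator (hSm.union hTm)
  refine (integral_mono_ae (hFi.sub hPi) hind (ae_restrict_of_ae hpt)).trans ?_
  rw [integral_indicator (hSm.union hTm), integral_const, smul_eq_mul,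
    Measure.restrict_restrict (hSm.union hTm)]
  have hvol : volume.real ((S ∪ T) ∩ symSquare) ≤ ε / (2 * C) + ε / (2 * C) := by
    refine ENNReal.toReal_le_of_le_ofReal (by positivity) ?_
    rw [inter_comm, inter_union_distrib_left, ENNReal.ofReal_add hε₀.le hε₀.le]
    exact (measure_union_le _ _).trans (add_le_add hSv hδv)
  rw [measureReal_restrict_apply_univ]
  calc _ ≤ (ε / (2 * C) + ε / (2 * C)) * C := mul_le_mul_of_nonneg_right hvol hC.le
    _ = ε := by field_simp; ring

theorem exists_eq_rankOneSum {ξ : Matrix (Fin 2) (Fin 2) ℝ} (hξ : ξ.IsSymm) :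
    ∃ c d a b : ℝ, c ^ 2 + d ^ 2 = 1 ∧ ξ = rankOneSum c d a b := by
  set z : ℂ := ⟨(ξ 0 0 - ξ 1 1) / 2, ξ 0 1⟩ with hz
  have hre : ‖z‖ * cos z.arg = (ξ 0 0 - ξ 1 1) / 2 := Complex.norm_mul_cos_arg z
  have him : ‖z‖ * sin z.arg = ξ 0 1 := Complex.norm_mul_sin_arg z
  have hcs : cos (z.arg / 2) ^ 2 + sin (z.arg / 2) ^ 2 = 1 := cos_sq_add_sin_sq _
  have hcos : cos z.arg = cos (z.arg / 2) ^ 2 - sin (z.arg / 2) ^ 2 := by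
    rw [← cos_two_mul']; congr 1; ring
  have hsin : sin z.arg = 2 * sin (z.arg / 2) * cos (z.arg / 2) := by
    rw [← sin_two_mul]; congr 1; ring
  rw [hcos] at hre
  rw [hsin] at him
  refine ⟨cos (z.arg / 2), sin (z.arg / 2), (ξ 0 0 + ξ 1 1) / 2 + ‖z‖,
    (ξ 0 0 + ξ 1 1) / 2 - ‖z‖, hcs, ?_⟩
  have h10 : ξ 1 0 = ξ 0 1 := hξ.apply 0 1
  ext i j
  fin_cases i <;> fin_cases j <;> simp [rankOneSum]
  · linear_combination -hre - (ξ 0 0 + ξ 1 1) / 2 * hcs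
  · linear_combination -him
  · linear_combination h10 - him
  · linear_combination hre - (ξ 0 0 + ξ 1 1) / 2 * hcs

theorem det_rankOneSum {c d : ℝ} (hcd : c ^ 2 + d ^ 2 = 1) (a b : ℝ) :
    (rankOneSum c d a b).det = a * b := by
  rw [Matrix.det_fin_two]
  simp only [rankOneSum, Matrix.of_apply, Matrix.cons_val', Matrix.cons_val_zero,
    Matrix.cons_val_one, Matrix.cons_val_fin_one]
  linear_combination (a * b) * (c ^ 2 + d ^ 2 + 1) * hcd

theorem rho0_rankOneSum {c d : ℝ} (hcd : c ^ 2 + d ^ 2 = 1) (a b : ℝ) :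
    rho0 (rankOneSum c d a b) = |a| + |b| := by
  have ht : (rankOneSum c d a b).trace = a + b := by
    rw [Matrix.trace_fin_two]
    simp only [rankOneSum, Matrix.of_apply, Matrix.cons_val', Matrix.cons_val_zero,
      Matrix.cons_val_one, Matrix.cons_val_fin_one]
    linear_combination (a + b) * hcd
  have hq : (a + b) ^ 2 - 4 * (a * b) = (a - b) ^ 2 := by ring
  rw [rho0, eig1, eig2, ht, det_rankOneSum hcd, hq, Real.sqrt_sq_eq_abs]
  rcases abs_cases (a - b) with ⟨h, -⟩ | ⟨h, -⟩ <;> rw [h]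
  · congr 2 <;> ring
  · rw [add_comm]
    congr 2 <;> ring

theorem exists_sign (a : ℝ) : ∃ e : ℝ, (e = 1 ∨ e = -1) ∧ e * a = |a| := by
  rcases abs_cases a with ⟨h, -⟩ | ⟨h, -⟩
  · exact ⟨1, Or.inl rfl, by rw [h, one_mul]⟩
  · exact ⟨-1, Or.inr rfl, by rw [h, neg_one_mul]⟩

/-- The 2-quasiconvexification of F_λ is given explicitly by Ḡ_λ. -/
theorem Q2_Flam_eq_Gbar (lam : ℝ) (hlam : 0 < lam)
    (ξ : Matrix (Fin 2) (Fin 2) ℝ) (hξ : ξ.IsSymm) :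
    Q2 (Flam lam) ξ = Gbar lam ξ := by
  obtain ⟨c, d, a, b, hcd, rfl⟩ := exists_eq_rankOneSum hξ
  obtain ⟨e₁, h₁, ha⟩ := exists_sign a
  obtain ⟨e₂, h₂, hb⟩ := exists_sign b
  set ξ := rankOneSum c d a b with hξ'
  have hs : √lam ^ 2 = lam := Real.sq_sqrt hlam.le
  have hs0 : 0 < √lam := Real.sqrt_pos.2 hlam
  have hab : (e₁ * e₂) * (a * b) = |a * b| := by rw [abs_mul, ← ha, ← hb]; ring
  have hP : ∀ k τ, supportLagrangian k τ c d e₁ e₂ ξ = k + 2 * τ * (|a| + |b|) - 2 * |a * b| :=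
    fun k τ => by
      rw [hξ', supportLagrangian_rankOneSum hcd, ha, hb, ← hab]
      ring
  have hsq : a ^ 2 + b ^ 2 = (|a| + |b|) ^ 2 - 2 * |a * b| := by
    rw [abs_mul, ← sq_abs a, ← sq_abs b]; ring
  have hG : Gbar lam ξ = if |a| + |b| ≤ √lam then 2 * √lam * (|a| + |b|) - 2 * |a * b|
      else a ^ 2 + b ^ 2 + lam := by
    rw [Gbar, hξ', rho0_rankOneSum hcd, det_rankOneSum hcd, sum_sq_rankOneSum hcd]
  have lower : ∀ φ, MemW2inf0 φ → Gbar lam ξ ≤ ∫ x in symSquare, Flam lam (ξ + hess φ x) := by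
    intro φ hφ
    rw [hG]
    split_ifs with h
    · have := hφ.supportLagrangian_le_integral ξ hcd hs.ge h₁ h₂
      rw [hP, hs] at this
      linarith
    · push Not at h
      have := hφ.supportLagrangian_le_integral ξ (lam := lam) (τ := |a| + |b|) hcd
        (by rw [← hs]; gcongr) h₁ h₂
      rw [hP] at this
      rw [hsq]
      linarith
  have hbdd : BddBelow {v : ℝ | ∃ φ : (Fin 2 → ℝ) → ℝ, MemW2inf0 φ ∧
      v = ∫ x in symSquare, Flam lam (ξ + hess φ x)} := by
    refine ⟨Gbar lam ξ, ?_⟩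
    rintro _ ⟨φ, hφ, rfl⟩
    exact lower φ hφ
  refine le_antisymm ?_ ?_
  · by_cases h : |a| + |b| < √lam
    · refine le_of_forall_pos_le_add fun ε hε => ?_
      obtain ⟨φ, hφ, hle⟩ := exists_energy_le hcd hs h₁ h₂ ha hb h hε
      refine (csInf_le hbdd ⟨φ, hφ, rfl⟩).trans (hle.trans_eq ?_)
      rw [← hξ', hP, hG, if_pos h.le, zero_add]
    · push Not at h
      refine (csInf_le hbdd ⟨_, memW2inf0_zero, rfl⟩).trans_eq ?_
      have hne : ξ ≠ 0 := by
        intro h0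
        have hz := sum_sq_rankOneSum hcd a b
        rw [← hξ', h0] at hz
        simp only [Matrix.zero_apply, Fin.sum_univ_two] at hz
        have h1 : a = 0 := by nlinarith [sq_nonneg a, sq_nonneg b]
        have h2 : b = 0 := by nlinarith [sq_nonneg a, sq_nonneg b]
        rw [h1, h2, abs_zero] at h
        linarith
      simp only [hess_zero, add_zero]
      rw [setIntegral_const, measureReal_def, volume_symSquare, ENNReal.toReal_one, one_smul, Flam,
        if_neg hne, hξ', sum_sq_rankOneSum hcd, ← hξ', hG]
      split_ifs with h'
      · have heq : |a| + |b| = √lam := le_antisymm h' h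
        rw [hsq, heq, hs]
        nlinarith
      · ring
  · refine le_csInf ⟨_, _, memW2inf0_zero, rfl⟩ ?_
    rintro _ ⟨φ, hφ, rfl⟩
    exact lower φ hφ
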